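/- Let G=(V,w) be a weighted graph, o a vertex and z a set of vertices with dist(o,z) ≥ n+1 for an integer n ≥ 1, and set g := (w_z r_{oz})^{1/n}, where r_{oz} is the effective resistance between o and z. If g > 1 then E[T_{oz}] ≥ n(g+1)/(g−1) + 1. -/

import Mathlib

open MeasureTheory Filter
open scoped Classical ENNReal

namespace RWHitting

/-- A weighted graph on a vertex set `V`: a symmetric weight function with
positive finite vertex weights. -/
structure WeightedGraph (V : Type*) where
  w : V → V → ℝ≥0∞
  symm : ∀ x y, w x y = w y x
  vw_pos : ∀ x, 0 < ∑' y, w x y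
  vw_lt_top : ∀ x, ∑' y, w x y < ⊤

namespace WeightedGraph

variable {V : Type*}

/-- The weight of a vertex. -/
noncomputable def vw (G : WeightedGraph V) (x : V) : ℝ≥0∞ := ∑' y, G.w x y

/-- The weight of a vertex set. -/
noncomputable def setWeight (G : WeightedGraph V) (z : Set V) : ℝ≥0∞ := ∑' x : z, G.vw x

/-- `G.distGE o z m` : every path of positive-weight steps from `o` into `z` has length `≥ m`. -/
def distGE (G : WeightedGraph V) (o : V) (z : Set V) (m : ℕ) : Prop :=
  ∀ (k : ℕ) (p : ℕ → V), p 0 = o → (∀ i, i < k → 0 < G.w (p i) (p (i+1))) → p k ∈ z → m ≤ k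

/-- Transition probabilities of the random walk on `G`. -/
noncomputable def trans (G : WeightedGraph V) (x y : V) : ℝ≥0∞ := G.w x y / G.vw x

/-- Graph distance (as an extended nonneg real). -/
noncomputable def edist (G : WeightedGraph V) (x y : V) : ℝ≥0∞ :=
  ⨅ (k : ℕ) (_ : ∃ p : ℕ → V, p 0 = x ∧ p k = y ∧ ∀ i, i < k → 0 < G.w (p i) (p (i+1))),
    (k : ℝ≥0∞)

/-- Total weight of the edges at distance `n` from `o` (each non-loop edge counted in both
orientations). -/
noncomputable def boundaryWeight (G : WeightedGraph V) (o : V) (n : ℕ) : ℝ≥0∞ :=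
  ∑' q : V × V, if min (G.edist o q.1) (G.edist o q.2) = (n : ℝ≥0∞) then G.w q.1 q.2 else 0

end WeightedGraph

variable {V : Type*}

/-- `μ` is the law of the random walk on `G` started at `o`. -/
def IsRandomWalk [MeasurableSpace V] (G : WeightedGraph V) (o : V)
    (μ : Measure (ℕ → V)) : Prop :=
  IsProbabilityMeasure μ ∧
  ∀ (k : ℕ) (x : Fin (k+1) → V),
    μ {ω | ∀ i : Fin (k+1), ω (i : ℕ) = x i}
      = (if x 0 = o then 1 else 0) * ∏ i : Fin k, G.trans (x i.castSucc) (x i.succ)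

/-- First hitting time of the set `z` (`∞` if `z` is never visited). -/
noncomputable def hitTime (z : Set V) (ω : ℕ → V) : ℝ≥0∞ :=
  ⨅ (k : ℕ) (_ : ω k ∈ z), (k : ℝ≥0∞)

/-- Expected hitting time of `z`. -/
noncomputable def expHit [MeasurableSpace V] (μ : Measure (ℕ → V)) (z : Set V) : ℝ≥0∞ :=
  ∫⁻ ω, hitTime z ω ∂μ

/-- Number of visits to `o` (counting time 0) strictly before hitting `z`. -/
noncomputable def visitsBefore (z : Set V) (o : V) (ω : ℕ → V) : ℝ≥0∞ :=
  ∑' k : ℕ, if ω k = o ∧ (k : ℝ≥0∞) < hitTime z ω then 1 else 0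

/-- Effective resistance between `o` and `z`, defined probabilistically via the random walk
law `μ`:  `w_o r_{oz}` is the expected number of visits to `o` before hitting `z`. -/
noncomputable def resistance [MeasurableSpace V] (G : WeightedGraph V) (o : V) (z : Set V)
    (μ : Measure (ℕ → V)) : ℝ≥0∞ :=
  (∫⁻ ω, visitsBefore z o ω ∂μ) / G.vw o

/-- One-step transition probabilities for the biased simple random walk on `ℤ`
with odds `1 : g` of going left/right. -/
noncomputable def biasedStep (g : ℝ) (a b : ℤ) : ℝ≥0∞ :=
  if b = a + 1 then ENNReal.ofReal (g / (g+1))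
  else if b = a - 1 then ENNReal.ofReal (1 / (g+1)) else 0

/-- `ν` is the law of the biased simple random walk on `ℤ` started at `0`,
stepping right with probability `g/(g+1)` and left with probability `1/(g+1)`. -/
def IsBiasedWalk (g : ℝ) (ν : Measure (ℕ → ℤ)) : Prop :=
  IsProbabilityMeasure ν ∧
  ∀ (k : ℕ) (x : Fin (k+1) → ℤ),
    ν {ω | ∀ i : Fin (k+1), ω (i : ℕ) = x i}
      = (if x 0 = 0 then 1 else 0) * ∏ i : Fin k, biasedStep g (x i.castSucc) (x i.succ)

/-- `e^{-λ t}` for an extended-real time `t`, with the convention `e^{-λ ∞} = 0`. -/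
noncomputable def expNeg (lam : ℝ) (t : ℝ≥0∞) : ℝ≥0∞ :=
  if t = ⊤ then 0 else ENNReal.ofReal (Real.exp (-lam * t.toReal))



/-- The tangent line inequality for `coth` at `log g / 2`, in multiplicative form. -/
lemma coth_tangent_of_lt {g a b : ℝ} (hg : 1 < g) (hb : 0 < b) (hab : b < a) :
    ((g + 1) / (g - 1) + 2 * g / (g - 1) ^ 2 * Real.log g) * (a - b)
      - 2 * g / (g - 1) ^ 2 * ((a - b) * (Real.log a - Real.log b)) ≤ a + b := by
  have ha : 0 < a := hb.trans hab
  have hg1 : 0 < g - 1 := by linarith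
  have hlog : Real.log g - (Real.log a - Real.log b) ≤ g * b / a - 1 := by
    rw [← Real.log_div ha.ne' hb.ne', ← Real.log_div (by positivity) (by positivity)]
    refine (Real.log_le_sub_one_of_pos (by positivity)).trans (le_of_eq ?_)
    field_simp
  have hB : 0 ≤ 2 * g / (g - 1) ^ 2 * (a - b) :=
    mul_nonneg (by positivity) (by linarith)
  have h1 := mul_le_mul_of_nonneg_left hlog hB
  have h2 : a + b - (g + 1) / (g - 1) * (a - b) - 2 * g / (g - 1) ^ 2 * (a - b) * (g * b / a - 1)
      = 2 * (g * b - a) ^ 2 / ((g - 1) ^ 2 * a) := by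
    field_simp
    ring
  have h3 : 0 ≤ 2 * (g * b - a) ^ 2 / ((g - 1) ^ 2 * a) := by positivity
  linarith

lemma coth_tangent {g a b : ℝ} (hg : 1 < g) (ha : 0 < a) (hb : 0 < b) :
    ((g + 1) / (g - 1) + 2 * g / (g - 1) ^ 2 * Real.log g) * |a - b|
      - 2 * g / (g - 1) ^ 2 * ((a - b) * (Real.log a - Real.log b)) ≤ a + b := by
  rcases lt_trichotomy a b with h | rfl | h
  · have := coth_tangent_of_lt hg ha h
    rw [abs_of_neg (by linarith)]
    linarith
  · simp; linarith
  · rw [abs_of_pos (by linarith)]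
    exact coth_tangent_of_lt hg hb h

/-- A unit flow from `o` along the gradient of the voltage `u`: the conductances are `d` between
interior vertices and `e` from interior vertices into the grounded set. -/
structure UnitFlow {V : Type*} (o : V) (d e : V × V → ℝ) (u : V → ℝ) : Prop where
  symm : ∀ p, d p.swap = d p
  d_nonneg : ∀ p, 0 ≤ d p
  e_nonneg : ∀ p, 0 ≤ e p
  u_nonneg : ∀ x, 0 ≤ u x
  summable_d : Summable fun p => d p * u p.1
  summable_e : Summable fun p => e p * u p.1
  div : ∀ x, ∑' y, (d (x, y) * (u x - u y) + e (x, y) * u x) = if x = o then 1 else 0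

namespace UnitFlow

variable {V : Type*} {o : V} {d e : V × V → ℝ} {u : V → ℝ}

lemma summable_d_snd (F : UnitFlow o d e u) : Summable fun p => d p * u p.2 := by
  refine ((Equiv.prodComm V V).summable_iff.2 F.summable_d).congr fun p => ?_
  simp [F.symm p]

lemma tsum_d_snd (F : UnitFlow o d e u) : ∑' p, d p * u p.2 = ∑' p, d p * u p.1 := by
  rw [← (Equiv.prodComm V V).tsum_eq fun p => d p * u p.1]
  exact tsum_congr fun p => by simp [F.symm p]

lemma summable_sub (F : UnitFlow o d e u) : Summable fun p => d p * (u p.1 - u p.2) :=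
  (F.summable_d.sub F.summable_d_snd).congr fun _ => by ring

lemma summable_mul_of_bounded {α : Type*} {f φ : α → ℝ} {M : ℝ} (hf : Summable f)
    (hφ : ∀ x, |φ x| ≤ M) : Summable fun x => f x * φ x := by
  refine Summable.of_norm_bounded (hf.abs.mul_right M) fun x => ?_
  rw [Real.norm_eq_abs, abs_mul]
  exact mul_le_mul_of_nonneg_left (hφ x) (abs_nonneg _)

lemma summable_energy (F : UnitFlow o d e u) {φ : V → ℝ} {M : ℝ} (hφ : ∀ x, |φ x| ≤ M) :
    Summable fun p : V × V => d p * (u p.1 - u p.2) * (φ p.1 - φ p.2) :=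
  summable_mul_of_bounded (M := M + M) F.summable_sub fun _ =>
    (abs_sub _ _).trans (add_le_add (hφ _) (hφ _))

/-- Discrete integration by parts against a bounded test function. -/
lemma energy_eq (F : UnitFlow o d e u) {φ : V → ℝ} {M : ℝ} (hφ : ∀ x, |φ x| ≤ M) :
    ∑' p : V × V, d p * (u p.1 - u p.2) * (φ p.1 - φ p.2)
      = 2 * (φ o - ∑' p, e p * u p.1 * φ p.1) := by
  have s1 : Summable fun p : V × V => d p * (u p.1 - u p.2) * φ p.1 :=
    summable_mul_of_bounded (φ := fun p : V × V => φ p.1) F.summable_sub fun p => hφ p.1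
  have s1' : Summable fun p : V × V => d p * (u p.1 - u p.2) * φ p.2 :=
    summable_mul_of_bounded (φ := fun p : V × V => φ p.2) F.summable_sub fun p => hφ p.2
  have s2 : Summable fun p : V × V => e p * u p.1 * φ p.1 :=
    summable_mul_of_bounded (φ := fun p : V × V => φ p.1) F.summable_e fun p => hφ p.1
  have htot : ∑' p : V × V, (d p * (u p.1 - u p.2) * φ p.1 + e p * u p.1 * φ p.1) = φ o := by
    rw [(s1.add s2).tsum_prod]
    have : ∀ x, ∑' y, (d (x, y) * (u x - u y) * φ x + e (x, y) * u x * φ x)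
        = (if x = o then 1 else 0) * φ x := fun x => by
      rw [← F.div x, ← tsum_mul_right]
      exact tsum_congr fun y => by ring
    simp [this]
  have hswap : ∑' p : V × V, d p * (u p.1 - u p.2) * φ p.2
      = -∑' p : V × V, d p * (u p.1 - u p.2) * φ p.1 := by
    rw [← (Equiv.prodComm V V).tsum_eq fun p => d p * (u p.1 - u p.2) * φ p.1, ← tsum_neg]
    exact tsum_congr fun p => by simp [F.symm p]; ring
  rw [s1.tsum_add s2] at htot
  calc ∑' p : V × V, d p * (u p.1 - u p.2) * (φ p.1 - φ p.2)
      = ∑' p : V × V, (d p * (u p.1 - u p.2) * φ p.1 - d p * (u p.1 - u p.2) * φ p.2) :=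
        tsum_congr fun p => by ring
    _ = _ := by rw [s1.tsum_sub s1', hswap]; linarith

lemma tsum_e (F : UnitFlow o d e u) : ∑' p, e p * u p.1 = 1 := by
  have := F.energy_eq (φ := fun _ => 1) (M := 1) (by simp)
  simp at this
  linarith

/-- Maximum principle on the vertices from which the flow enters the grounded set. -/
lemma le_source (F : UnitFlow o d e u) (p : V × V) (hp : 0 < e p) : u p.1 ≤ u o := by
  by_contra! hlt
  set φ : V → ℝ := fun x => min 1 (max 0 (u x - u o)) with hφdef
  have hφ0 : ∀ x, 0 ≤ φ x := fun x => le_min zero_le_one (le_max_left _ _)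
  have hφ : ∀ x, |φ x| ≤ 1 := fun x => by
    rw [abs_of_nonneg (hφ0 x)]; exact min_le_left _ _
  have hE := F.energy_eq hφ
  have hpos : 0 ≤ ∑' p : V × V, d p * (u p.1 - u p.2) * (φ p.1 - φ p.2) := by
    refine tsum_nonneg fun p => ?_
    rw [mul_assoc]
    refine mul_nonneg (F.d_nonneg p) ?_
    have hm : ∀ x y, u x ≤ u y → φ x ≤ φ y := fun x y h =>
      min_le_min le_rfl (max_le_max le_rfl (by linarith))
    rcases le_total (u p.1) (u p.2) with h | h
    · exact mul_nonneg_of_nonpos_of_nonpos (by linarith) (by linarith [hm _ _ h])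
    · exact mul_nonneg (by linarith) (by linarith [hm _ _ h])
  have hφo : φ o = 0 := by simp [hφdef]
  have hs : Summable fun p : V × V => e p * u p.1 * φ p.1 :=
    summable_mul_of_bounded (φ := fun p : V × V => φ p.1) F.summable_e fun p => hφ p.1
  have hle := hs.le_tsum p fun q _ => mul_nonneg (mul_nonneg (F.e_nonneg q) (F.u_nonneg _)) (hφ0 _)
  have hup : 0 < u p.1 := (F.u_nonneg o).trans_lt hlt
  have hφp : 0 < φ p.1 := lt_min one_pos (lt_max_of_lt_right (by linarith))
  have : 0 < e p * u p.1 * φ p.1 := by positivity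
  linarith

/-- The net flow times length is at least the distance to the grounded set. -/
lemma two_mul_le_tsum_abs (F : UnitFlow o d e u) {h : V → ℝ} {n : ℝ} (h0 : h o = 0)
    (hb : ∀ x, |h x| ≤ n) (hd : ∀ p, d p ≠ 0 → |h p.1 - h p.2| ≤ 1)
    (he : ∀ p, e p ≠ 0 → h p.1 = n) :
    2 * n ≤ ∑' p : V × V, d p * |u p.1 - u p.2| := by
  have hE := F.energy_eq hb
  have hz : ∑' p : V × V, e p * u p.1 * h p.1 = n := by
    rw [← one_mul n, ← F.tsum_e, ← tsum_mul_right]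
    refine tsum_congr fun p => ?_
    by_cases hp : e p = 0
    · simp [hp]
    · rw [he p hp]
  have habs : Summable fun p : V × V => d p * |u p.1 - u p.2| :=
    F.summable_sub.abs.congr fun p => by rw [abs_mul, abs_of_nonneg (F.d_nonneg p)]
  have hle : ∑' p : V × V, -(d p * (u p.1 - u p.2) * (h p.1 - h p.2))
      ≤ ∑' p : V × V, d p * |u p.1 - u p.2| := by
    refine (F.summable_energy hb).neg.tsum_le_tsum (fun p => ?_) habs
    by_cases hp : d p = 0
    · simp [hp]
    · refine (neg_le_abs _).trans ?_
      rw [abs_mul, abs_mul, abs_of_nonneg (F.d_nonneg p)]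
      exact mul_le_of_le_one_right (mul_nonneg (F.d_nonneg p) (abs_nonneg _)) (hd p hp)
  rw [tsum_neg, hE, hz, h0] at hle
  linarith

lemma energy_log_nonneg (F : UnitFlow o d e u) (hpos : ∀ p, d p ≠ 0 → 0 < u p.1 → 0 < u p.2)
    {φ : V → ℝ} (hm : ∀ x y, 0 < u x → u x ≤ u y → φ x ≤ φ y) (p : V × V) :
    0 ≤ d p * (u p.1 - u p.2) * (φ p.1 - φ p.2) := by
  by_cases hp : d p = 0
  · simp [hp]
  rw [mul_assoc]
  refine mul_nonneg (F.d_nonneg p) ?_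
  rcases (F.u_nonneg p.1).eq_or_lt with h1 | h1
  · rcases (F.u_nonneg p.2).eq_or_lt with h2 | h2
    · simp [← h1, ← h2]
    · have := hpos p.swap (by rwa [F.symm]) h2
      exact absurd h1 this.ne
  have h2 := hpos p hp h1
  rcases le_total (u p.1) (u p.2) with h | h
  · exact mul_nonneg_of_nonpos_of_nonpos (by linarith) (by linarith [hm _ _ h1 h])
  · exact mul_nonneg (by linarith) (by linarith [hm _ _ h2 h])

/-- The entropy-type bound: the logarithmic energy of the flow is at most `log (W * u o)`. -/
lemma sum_energy_log_le (F : UnitFlow o d e u) (hpos : ∀ p, d p ≠ 0 → 0 < u p.1 → 0 < u p.2)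
    (ho : 0 < u o) {W : ℝ} (hW : 0 < W) (hse : Summable e) (heW : ∑' p, e p ≤ W)
    (S : Finset (V × V)) :
    ∑ p ∈ S, d p * (u p.1 - u p.2) * (Real.log (u p.1) - Real.log (u p.2))
      ≤ 2 * Real.log (W * u o) := by
  set φ : ℕ → V → ℝ := fun N x => max (-(N : ℝ)) (min N (Real.log (u x))) with hφdef
  have hφ : ∀ N x, |φ N x| ≤ N := fun N x =>
    abs_le.2 ⟨le_max_left _ _, max_le (by linarith [N.cast_nonneg (α := ℝ)]) (min_le_left _ _)⟩
  have hev : ∀ x, ∀ᶠ N : ℕ in atTop, φ N x = Real.log (u x) := fun x => by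
    filter_upwards [tendsto_natCast_atTop_atTop.eventually_ge_atTop |Real.log (u x)|] with N hN
    have := abs_le.1 hN
    simp only [hφdef]
    rw [min_eq_right this.2, max_eq_right this.1]
  have hevS : ∀ᶠ N : ℕ in atTop, ∀ p ∈ S,
      φ N p.1 = Real.log (u p.1) ∧ φ N p.2 = Real.log (u p.2) :=
    (Filter.eventually_all_finset S).2 fun p _ => (hev p.1).and (hev p.2)
  obtain ⟨N, hNS, hNo⟩ := (hevS.and (hev o)).exists
  have hNle : Real.log (u o) ≤ N := by rw [← hNo]; exact (le_abs_self _).trans (hφ N o)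
  have hmono : ∀ x y, 0 < u x → u x ≤ u y → φ N x ≤ φ N y := fun x y hx hxy =>
    max_le_max le_rfl (min_le_min le_rfl (Real.log_le_log hx hxy))
  have hE := F.energy_eq (hφ N)
  have hsum : ∑ p ∈ S, d p * (u p.1 - u p.2) * (Real.log (u p.1) - Real.log (u p.2))
      ≤ ∑' p : V × V, d p * (u p.1 - u p.2) * (φ N p.1 - φ N p.2) := by
    refine le_trans (le_of_eq ?_) ((F.summable_energy (hφ N)).sum_le_tsum S
      fun p _ => F.energy_log_nonneg hpos hmono p)
    exact Finset.sum_congr rfl fun p hp => by rw [(hNS p hp).1, (hNS p hp).2]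
  have hs2 : Summable fun p : V × V => e p * u p.1 * φ N p.1 :=
    summable_mul_of_bounded (φ := fun p : V × V => φ N p.1) F.summable_e fun p => hφ N p.1
  have hz : ∑' p : V × V, (e p * u p.1 * (1 - Real.log W) - e p / W)
      ≤ ∑' p : V × V, e p * u p.1 * φ N p.1 := by
    refine ((F.summable_e.mul_right _).sub (hse.div_const W)).tsum_le_tsum (fun p => ?_) hs2
    rcases (F.e_nonneg p).eq_or_lt with hp | hp
    · simp [← hp]
    rcases (F.u_nonneg p.1).eq_or_lt with hu | hu
    · rw [← hu]
      have : 0 ≤ e p / W := by positivity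
      simpa using this
    have hle : Real.log (u p.1) ≤ φ N p.1 :=
      le_max_of_le_right (le_min ((Real.log_le_log hu (F.le_source p hp)).trans hNle) le_rfl)
    have hl : -(Real.log W + Real.log (u p.1)) ≤ 1 / (W * u p.1) - 1 := by
      rw [← Real.log_mul hW.ne' hu.ne', ← Real.log_inv, ← one_div]
      exact Real.log_le_sub_one_of_pos (by positivity)
    have h3 : e p / W = e p * u p.1 * (1 / (W * u p.1)) := by field_simp
    rw [h3, ← mul_sub]
    exact mul_le_mul_of_nonneg_left (by linarith) (by positivity)
  rw [(F.summable_e.mul_right _).tsum_sub (hse.div_const W), tsum_mul_right, F.tsum_e,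
    tsum_div_const] at hz
  have h1 : (∑' p, e p) / W ≤ 1 := (div_le_one hW).2 heW
  rw [Real.log_mul hW.ne' ho.ne']
  rw [hE, hNo] at hsum
  linarith

theorem le_tsum (F : UnitFlow o d e u) (hpos : ∀ p, d p ≠ 0 → 0 < u p.1 → 0 < u p.2)
    (ho : 0 < u o) {W : ℝ} (hW : 0 < W) (hse : Summable e) (heW : ∑' p, e p ≤ W)
    {h : V → ℝ} {n : ℕ} (h0 : h o = 0)
    (hb : ∀ x, |h x| ≤ n) (hd : ∀ p, d p ≠ 0 → |h p.1 - h p.2| ≤ 1)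
    (he : ∀ p, e p ≠ 0 → h p.1 = n) {g : ℝ} (hg : 1 < g) (hgn : g ^ n = W * u o) :
    n * (g + 1) / (g - 1) + 1 ≤ ∑' p, d p * u p.1 + ∑' p, e p * u p.1 := by
  have hg1 : 0 < g - 1 := by linarith
  have hnn := F.energy_log_nonneg hpos (φ := fun x => Real.log (u x))
    (fun x y hx hxy => Real.log_le_log hx hxy)
  have hsl := F.sum_energy_log_le hpos ho hW hse heW
  have hS := summable_of_sum_le hnn hsl
  have hlog : ∑' p : V × V, d p * (u p.1 - u p.2) * (Real.log (u p.1) - Real.log (u p.2))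
      ≤ 2 * (n * Real.log g) := by
    rw [← Real.log_pow, hgn]
    exact hS.tsum_le_of_sum_le hsl
  have habs := F.two_mul_le_tsum_abs h0 hb hd he
  have hSabs : Summable fun p : V × V => d p * |u p.1 - u p.2| :=
    F.summable_sub.abs.congr fun p => by rw [abs_mul, abs_of_nonneg (F.d_nonneg p)]
  set B := 2 * g / (g - 1) ^ 2
  set C := (g + 1) / (g - 1) + B * Real.log g with hC
  have hB0 : 0 ≤ B := by positivity
  have hC0 : 0 ≤ C := by
    have := Real.log_nonneg hg.le
    positivity
  have key : ∑' p : V × V, (C * (d p * |u p.1 - u p.2|)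
      - B * (d p * (u p.1 - u p.2) * (Real.log (u p.1) - Real.log (u p.2))))
      ≤ ∑' p : V × V, (d p * u p.1 + d p * u p.2) := by
    refine ((hSabs.mul_left C).sub (hS.mul_left B)).tsum_le_tsum (fun p => ?_)
      (F.summable_d.add F.summable_d_snd)
    by_cases hp : d p = 0
    · simp [hp]
    rcases (F.u_nonneg p.1).eq_or_lt with h1 | h1
    · rcases (F.u_nonneg p.2).eq_or_lt with h2 | h2
      · simp [← h1, ← h2]
      · exact absurd h1 (hpos p.swap (by rwa [F.symm]) h2).ne
    have := mul_le_mul_of_nonneg_left (coth_tangent hg h1 (hpos p hp h1)) (F.d_nonneg p)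
    linarith
  rw [(hSabs.mul_left C).tsum_sub (hS.mul_left B), F.summable_d.tsum_add F.summable_d_snd,
    tsum_mul_left, tsum_mul_left, F.tsum_d_snd] at key
  have k1 := mul_le_mul_of_nonneg_left habs hC0
  have k2 := mul_le_mul_of_nonneg_left hlog hB0
  have k3 : C * (2 * n) - B * (2 * (n * Real.log g)) = 2 * (n * (g + 1) / (g - 1)) := by
    rw [hC]; ring
  rw [F.tsum_e]
  linarith

end UnitFlow
section Walk

variable {V : Type*}

lemma natCast_lt_hitTime {z : Set V} {ω : ℕ → V} {k : ℕ} :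
    (k : ℝ≥0∞) < hitTime z ω ↔ ∀ j ≤ k, ω j ∉ z := by
  constructor
  · intro h j hj hz
    exact absurd ((iInf₂_le j hz).trans (Nat.cast_le.2 hj)) h.not_ge
  · intro h
    refine lt_of_lt_of_le (b := ((k + 1 : ℕ) : ℝ≥0∞)) (Nat.cast_lt.2 k.lt_succ_self) ?_
    refine le_iInf₂ fun m hm => Nat.cast_le.2 ?_
    by_contra! hlt
    exact h m (by omega) hm

lemma hitTime_eq_tsum (z : Set V) (ω : ℕ → V) :
    hitTime z ω = ∑' k : ℕ, if (k : ℝ≥0∞) < hitTime z ω then 1 else 0 := by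
  by_cases h : ∃ k, ω k ∈ z
  · have hN : hitTime z ω = (Nat.find h : ℕ) := by
      refine le_antisymm (iInf₂_le (Nat.find h) (Nat.find_spec h)) (le_iInf₂ fun m hm => ?_)
      exact Nat.cast_le.2 (Nat.find_min' h hm)
    rw [hN, tsum_eq_sum (s := Finset.range (Nat.find h))]
    · rw [Finset.sum_congr rfl fun k hk => if_pos (Nat.cast_lt.2 (Finset.mem_range.1 hk))]
      simp
    · intro k hk
      rw [if_neg]
      simpa using hk
  · push Not at h
    have : hitTime z ω = ⊤ := by simp [hitTime, h]
    simp [this]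

variable [MeasurableSpace V]

/-- The probability that the walk is at `x` at time `k` and has not hit `z` yet. -/
noncomputable def aliveProb (μ : Measure (ℕ → V)) (z : Set V) (k : ℕ) (x : V) : ℝ≥0∞ :=
  μ {ω | ω k = x ∧ ∀ j ≤ k, ω j ∉ z}

/-- The Green function: expected number of visits to `x` before hitting `z`. -/
noncomputable def green (μ : Measure (ℕ → V)) (z : Set V) (x : V) : ℝ≥0∞ :=
  ∑' k, aliveProb μ z k x

lemma aliveProb_eq_zero (μ : Measure (ℕ → V)) {z : Set V} (k : ℕ) {x : V} (hx : x ∈ z) :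
    aliveProb μ z k x = 0 := by
  have : {ω : ℕ → V | ω k = x ∧ ∀ j ≤ k, ω j ∉ z} = ∅ := by
    ext ω
    simp only [Set.mem_ofPred_eq, Set.mem_empty_iff_false, iff_false, not_and]
    rintro rfl h
    exact h k le_rfl hx
  simp [aliveProb, this]

lemma green_eq_zero (μ : Measure (ℕ → V)) {z : Set V} {x : V} (hx : x ∈ z) :
    green μ z x = 0 := by
  simp [green, aliveProb_eq_zero μ _ hx]

lemma aliveProb_zero {G : WeightedGraph V} {o : V} {μ : Measure (ℕ → V)}
    (hμ : IsRandomWalk G o μ) {z : Set V} {y : V} (hy : y ∉ z) :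
    aliveProb μ z 0 y = if y = o then 1 else 0 := by
  have := hμ.2 0 (fun _ => y)
  simp only [Finset.univ_eq_empty, Finset.prod_empty, mul_one] at this
  rw [← this, aliveProb]
  congr 1
  ext ω
  simp only [Set.mem_ofPred_eq, nonpos_iff_eq_zero, forall_eq]
  refine ⟨fun h i => ?_, fun h => ?_⟩
  · rw [Fin.val_eq_zero i]
    exact h.1
  · have h0 : ω 0 = y := h 0
    exact ⟨h0, h0 ▸ hy⟩

lemma measurableSet_eval_eq [MeasurableSingletonClass V] (k : ℕ) (x : V) :
    MeasurableSet {ω : ℕ → V | ω k = x} := by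
  have hm : Measurable fun ω : ℕ → V => ω k := measurable_pi_apply k
  exact hm (measurableSet_singleton x)

lemma measurableSet_cylinder [MeasurableSingletonClass V] (k : ℕ) (s : Fin (k + 1) → V) :
    MeasurableSet {ω : ℕ → V | (fun i : Fin (k + 1) => ω i) = s} := by
  have hm : Measurable fun (ω : ℕ → V) (i : Fin (k + 1)) => ω i :=
    measurable_pi_lambda _ fun i => measurable_pi_apply _
  exact hm (measurableSet_singleton s)

lemma measure_eq_tsum_fiber {α : Type*} [Countable α] (μ : Measure (ℕ → V)) {A : Set (ℕ → V)}
    (hA : MeasurableSet A) (f : (ℕ → V) → α) (hf : ∀ a, MeasurableSet {ω | f ω = a}) :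
    μ A = ∑' a, μ (A ∩ {ω | f ω = a}) := by
  rw [← measure_iUnion _ fun a => hA.inter (hf a)]
  · congr 1
    ext ω
    simp
  · intro a b hab
    refine Set.disjoint_left.2 fun ω h1 h2 => hab ?_
    rw [← h1.2, h2.2]

variable [Countable V] [MeasurableSingletonClass V]

lemma measurableSet_alive (z : Set V) (k : ℕ) : MeasurableSet {ω : ℕ → V | ∀ j ≤ k, ω j ∉ z} := by
  simp only [Set.ofPred_forall]
  refine MeasurableSet.iInter fun j => MeasurableSet.iInter fun _ => ?_
  have hm : Measurable fun ω : ℕ → V => ω j := measurable_pi_apply j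
  exact hm (MeasurableSet.of_discrete (s := zᶜ))

lemma measurableSet_eval_eq_alive (z : Set V) (k : ℕ) (x : V) :
    MeasurableSet {ω : ℕ → V | ω k = x ∧ ∀ j ≤ k, ω j ∉ z} :=
  (measurableSet_eval_eq k x).inter (measurableSet_alive z k)

lemma lintegral_visitsBefore (μ : Measure (ℕ → V)) (z : Set V) (x : V) :
    ∫⁻ ω, visitsBefore z x ω ∂μ = green μ z x := by
  have h : ∀ ω, visitsBefore z x ω
      = ∑' k, {ω : ℕ → V | ω k = x ∧ ∀ j ≤ k, ω j ∉ z}.indicator (fun _ => (1 : ℝ≥0∞)) ω :=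
    fun ω => tsum_congr fun k => by
      simp only [natCast_lt_hitTime, Set.indicator_apply, Set.mem_ofPred_eq]
  simp_rw [h]
  rw [lintegral_tsum fun k =>
    (measurable_const.indicator (measurableSet_eval_eq_alive z k x)).aemeasurable]
  exact tsum_congr fun k => by
    rw [lintegral_indicator_const (measurableSet_eval_eq_alive z k x), one_mul, aliveProb]

lemma expHit_eq_tsum_green (μ : Measure (ℕ → V)) (z : Set V) :
    expHit μ z = ∑' x, green μ z x := by
  have h : ∀ ω, hitTime z ω
      = ∑' k, {ω : ℕ → V | ∀ j ≤ k, ω j ∉ z}.indicator (fun _ => (1 : ℝ≥0∞)) ω := fun ω => by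
    rw [hitTime_eq_tsum]
    exact tsum_congr fun k => by
      simp only [natCast_lt_hitTime, Set.indicator_apply, Set.mem_ofPred_eq]
  simp_rw [expHit, h, green]
  rw [lintegral_tsum fun k =>
    (measurable_const.indicator (measurableSet_alive z k)).aemeasurable, ENNReal.tsum_comm]
  refine tsum_congr fun k => ?_
  rw [lintegral_indicator_const (measurableSet_alive z k), one_mul,
    measure_eq_tsum_fiber μ (measurableSet_alive z k) (fun ω => ω k) (measurableSet_eval_eq k)]
  exact tsum_congr fun x => congrArg μ (Set.inter_comm _ _)

lemma aliveProb_eq_tsum (μ : Measure (ℕ → V)) (z : Set V) (k : ℕ) (x : V) :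
    aliveProb μ z k x = ∑' s : Fin (k + 1) → V,
      if x = s (Fin.last k) then (if ∀ i, s i ∉ z then
        μ {ω | ∀ i : Fin (k + 1), ω i = s i} else 0) else 0 := by
  rw [aliveProb, measure_eq_tsum_fiber μ (measurableSet_eval_eq_alive z k x)
    (fun ω (i : Fin (k + 1)) => ω i) (measurableSet_cylinder k)]
  refine tsum_congr fun s => ?_
  rw [← ite_and]
  split_ifs with h
  · congr 1
    ext ω
    simp only [Set.mem_inter_iff, Set.mem_ofPred_eq, funext_iff]
    refine ⟨fun H => H.2, fun H => ⟨⟨?_, fun j hj => ?_⟩, H⟩⟩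
    · rw [h.1]; exact H (Fin.last k)
    · have := H ⟨j, by omega⟩
      simp only at this
      rw [this]; exact h.2 _
  · convert measure_empty (μ := μ)
    ext ω
    simp only [Set.mem_inter_iff, Set.mem_ofPred_eq, Set.mem_empty_iff_false, iff_false]
    rintro ⟨⟨h1, h2⟩, rfl⟩
    exact h ⟨h1.symm, fun i => h2 i (by omega)⟩

lemma aliveProb_succ {G : WeightedGraph V} {o : V} {μ : Measure (ℕ → V)}
    (hμ : IsRandomWalk G o μ) {z : Set V} (k : ℕ) {y : V} (hy : y ∉ z) :
    aliveProb μ z (k + 1) y = ∑' x, aliveProb μ z k x * G.trans x y := by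
  have h1 : ∀ s : Fin (k + 1) → V, μ ({ω : ℕ → V | ω (k + 1) = y ∧ ∀ j ≤ k + 1, ω j ∉ z} ∩
      {ω | (fun i : Fin (k + 1) => ω i) = s}) = if ∀ i, s i ∉ z then
        μ {ω | ∀ i : Fin (k + 1), ω i = s i} * G.trans (s (Fin.last k)) y else 0 := by
    intro s
    split_ifs with h
    · have hset : ({ω : ℕ → V | ω (k + 1) = y ∧ ∀ j ≤ k + 1, ω j ∉ z} ∩
          {ω | (fun i : Fin (k + 1) => ω i) = s})
          = {ω | ∀ i : Fin (k + 1 + 1), ω i = (Fin.snoc s y : Fin (k + 1 + 1) → V) i} := by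
        ext ω
        simp only [Set.mem_inter_iff, Set.mem_ofPred_eq, funext_iff, Fin.forall_fin_succ',
          Fin.snoc_castSucc, Fin.snoc_last, Fin.val_castSucc, Fin.val_last]
        refine ⟨fun H => ⟨H.2, H.1.1⟩, fun H => ⟨⟨H.2, fun j hj => ?_⟩, H.1⟩⟩
        rcases hj.eq_or_lt with rfl | hj
        · rw [H.2]; exact hy
        · have := (Fin.forall_fin_succ' (P := fun i : Fin (k + 1) => ω i = s i)).2 H.1 ⟨j, hj⟩
          simp only at this
          rw [this]; exact h _
      rw [hset, hμ.2, hμ.2, Fin.prod_univ_castSucc, ← mul_assoc]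
      have h0 : (Fin.snoc s y : Fin (k + 1 + 1) → V) 0 = s 0 := by
        rw [← Fin.castSucc_zero, Fin.snoc_castSucc]
      simp only [h0, Fin.snoc_castSucc, Fin.succ_castSucc, Fin.succ_last, Fin.snoc_last]
    · convert measure_empty (μ := μ)
      ext ω
      simp only [Set.mem_inter_iff, Set.mem_ofPred_eq, Set.mem_empty_iff_false, iff_false]
      rintro ⟨⟨-, h2⟩, rfl⟩
      exact h fun i => h2 i (by omega)
  rw [aliveProb, measure_eq_tsum_fiber μ (measurableSet_eval_eq_alive z (k + 1) y)
    (fun ω (i : Fin (k + 1)) => ω i) (measurableSet_cylinder k)]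
  simp_rw [h1, aliveProb_eq_tsum, ← ENNReal.tsum_mul_right]
  rw [ENNReal.tsum_comm]
  refine tsum_congr fun s => ?_
  simp only [ite_mul, zero_mul]
  rw [tsum_ite_eq]

lemma green_eq {G : WeightedGraph V} {o : V} {μ : Measure (ℕ → V)}
    (hμ : IsRandomWalk G o μ) {z : Set V} {y : V} (hy : y ∉ z) :
    green μ z y = (if y = o then 1 else 0) + ∑' x, green μ z x / G.vw x * G.w x y := by
  rw [green, tsum_eq_zero_add' ENNReal.summable, aliveProb_zero hμ hy]
  simp_rw [aliveProb_succ hμ _ hy]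
  rw [ENNReal.tsum_comm]
  congr 1
  refine tsum_congr fun x => ?_
  rw [ENNReal.tsum_mul_right, WeightedGraph.trans, green, div_eq_mul_inv, div_eq_mul_inv]
  ring

end Walk

namespace WeightedGraph

variable {V : Type*}

/-- The graph distance from `o`, truncated at `n`. -/
noncomputable def truncDist (G : WeightedGraph V) (o : V) (n : ℕ) (x : V) : ℕ :=
  sInf {k | k = n ∨ ∃ p : ℕ → V, p 0 = o ∧ (∀ i, i < k → 0 < G.w (p i) (p (i + 1))) ∧ p k = x}

lemma exists_path_succ (G : WeightedGraph V) {o x y : V} {k : ℕ} (hxy : 0 < G.w x y)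
    (h : ∃ p : ℕ → V, p 0 = o ∧ (∀ i, i < k → 0 < G.w (p i) (p (i + 1))) ∧ p k = x) :
    ∃ p : ℕ → V, p 0 = o ∧ (∀ i, i < k + 1 → 0 < G.w (p i) (p (i + 1))) ∧ p (k + 1) = y := by
  obtain ⟨p, h0, hp, hk⟩ := h
  refine ⟨fun i => if i ≤ k then p i else y, by simp [h0], fun i hi => ?_, by simp⟩
  rcases (Nat.lt_succ_iff.1 hi).eq_or_lt with rfl | hi
  · simpa [hk] using hxy
  · have h1 : i ≤ k := hi.le
    have h2 : i + 1 ≤ k := hi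
    simpa [h1, h2] using hp i hi

lemma truncDist_le (G : WeightedGraph V) (o : V) (n : ℕ) (x : V) : G.truncDist o n x ≤ n :=
  Nat.sInf_le (Or.inl rfl)

lemma truncDist_self (G : WeightedGraph V) (o : V) (n : ℕ) : G.truncDist o n o = 0 :=
  Nat.sInf_eq_zero.2 (Or.inl (Or.inr ⟨fun _ => o, rfl, by simp, rfl⟩))

lemma truncDist_spec (G : WeightedGraph V) (o : V) (n : ℕ) (x : V) :
    G.truncDist o n x = n ∨ ∃ p : ℕ → V, p 0 = o ∧
      (∀ i, i < G.truncDist o n x → 0 < G.w (p i) (p (i + 1))) ∧ p (G.truncDist o n x) = x :=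
  Nat.sInf_mem (s := {k | k = n ∨ ∃ p : ℕ → V, p 0 = o ∧
    (∀ i, i < k → 0 < G.w (p i) (p (i + 1))) ∧ p k = x}) ⟨n, Or.inl rfl⟩

lemma truncDist_le_add_one (G : WeightedGraph V) {o : V} {n : ℕ} {x y : V} (hxy : 0 < G.w x y) :
    G.truncDist o n y ≤ G.truncDist o n x + 1 := by
  rcases G.truncDist_spec o n x with h | h
  · have := G.truncDist_le o n y
    omega
  · exact Nat.sInf_le (Or.inr (G.exists_path_succ hxy h))

lemma truncDist_eq_of_distGE (G : WeightedGraph V) {o : V} {n : ℕ} {z : Set V}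
    (hdist : G.distGE o z (n + 1)) {x y : V} (hy : y ∈ z) (hxy : 0 < G.w x y) :
    G.truncDist o n x = n := by
  rcases G.truncDist_spec o n x with h | h
  · exact h
  · obtain ⟨p, h0, hp, hk⟩ := G.exists_path_succ hxy h
    have := hdist _ p h0 hp (hk ▸ hy)
    have := G.truncDist_le o n x
    omega

lemma notMem_of_distGE (G : WeightedGraph V) {o : V} {n : ℕ} {z : Set V}
    (hdist : G.distGE o z (n + 1)) : o ∉ z := fun h => by
  have := hdist 0 (fun _ => o) rfl (by simp) h
  omega

lemma w_ne_top (G : WeightedGraph V) (x y : V) : G.w x y ≠ ⊤ :=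
  ((ENNReal.le_tsum y).trans_lt (G.vw_lt_top x)).ne

/-- The weights of the edges avoiding `z`. -/
noncomputable def interior (G : WeightedGraph V) (z : Set V) (p : V × V) : ℝ :=
  if p.1 ∉ z ∧ p.2 ∉ z then (G.w p.1 p.2).toReal else 0

/-- The weights of the edges entering `z`. -/
noncomputable def entering (G : WeightedGraph V) (z : Set V) (p : V × V) : ℝ :=
  if p.1 ∉ z ∧ p.2 ∈ z then (G.w p.1 p.2).toReal else 0

lemma w_pos_of_interior_ne_zero (G : WeightedGraph V) {z : Set V} {p : V × V}
    (hp : G.interior z p ≠ 0) : p.1 ∉ z ∧ p.2 ∉ z ∧ 0 < G.w p.1 p.2 := by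
  rw [interior] at hp
  split_ifs at hp with h
  · exact ⟨h.1, h.2, pos_iff_ne_zero.2 fun h0 => hp (by simp [h0])⟩
  · exact absurd rfl hp

lemma w_pos_of_entering_ne_zero (G : WeightedGraph V) {z : Set V} {p : V × V}
    (hp : G.entering z p ≠ 0) : p.2 ∈ z ∧ 0 < G.w p.1 p.2 := by
  rw [entering] at hp
  split_ifs at hp with h
  · exact ⟨h.2, pos_iff_ne_zero.2 fun h0 => hp (by simp [h0])⟩
  · exact absurd rfl hp

lemma tsum_entering_le (G : WeightedGraph V) {z : Set V} (hz : G.setWeight z ≠ ⊤) :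
    Summable (G.entering z) ∧ ∑' p, G.entering z p ≤ (G.setWeight z).toReal := by
  have hle : ∑' p : V × V, (if p.1 ∉ z ∧ p.2 ∈ z then G.w p.1 p.2 else 0) ≤ G.setWeight z := by
    rw [ENNReal.tsum_prod (f := fun x y => if x ∉ z ∧ y ∈ z then G.w x y else 0),
      ENNReal.tsum_comm, setWeight, tsum_subtype z G.vw]
    refine ENNReal.tsum_le_tsum fun y => ?_
    by_cases hy : y ∈ z
    · rw [Set.indicator_of_mem hy, vw]
      refine ENNReal.tsum_le_tsum fun x => ?_
      split_ifs
      · exact (G.symm x y).le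
      · exact zero_le
    · simp [hy]
  have heq : G.entering z
      = fun p : V × V => (if p.1 ∉ z ∧ p.2 ∈ z then G.w p.1 p.2 else 0).toReal := by
    ext p
    rw [entering]
    split_ifs <;> simp
  have hne := ne_top_of_le_ne_top hz hle
  rw [heq]
  refine ⟨ENNReal.summable_toReal hne, ?_⟩
  rw [← ENNReal.tsum_toReal_eq (ENNReal.ne_top_of_tsum_ne_top hne)]
  exact ENNReal.toReal_mono hz hle

end WeightedGraph

/-- The voltage: the Green function normalised by the vertex weights. -/
noncomputable def voltage {V : Type*} [MeasurableSpace V] (G : WeightedGraph V) (z : Set V)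
    (μ : Measure (ℕ → V)) (x : V) : ℝ≥0∞ :=
  green μ z x / G.vw x

section Voltage

variable {V : Type*} [MeasurableSpace V] {G : WeightedGraph V} {o : V} {z : Set V}
  {μ : Measure (ℕ → V)}

lemma voltage_mul_vw (x : V) : voltage G z μ x * G.vw x = green μ z x :=
  ENNReal.div_mul_cancel (G.vw_pos x).ne' (G.vw_lt_top x).ne

lemma voltage_eq_zero {x : V} (hx : x ∈ z) : voltage G z μ x = 0 := by
  simp [voltage, green_eq_zero μ hx]

lemma voltage_pos {x : V} (hx : 0 < green μ z x) : 0 < voltage G z μ x :=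
  ENNReal.div_pos hx.ne' (G.vw_lt_top x).ne

lemma interior_add_entering (p : V × V) :
    G.interior z p * (voltage G z μ p.1).toReal + G.entering z p * (voltage G z μ p.1).toReal
      = (G.w p.1 p.2).toReal * (voltage G z μ p.1).toReal := by
  by_cases h1 : p.1 ∈ z
  · simp [voltage_eq_zero h1]
  · by_cases h2 : p.2 ∈ z <;> simp [WeightedGraph.interior, WeightedGraph.entering, h1, h2]

variable [Countable V] [MeasurableSingletonClass V]

lemma green_ne_top (hT : expHit μ z ≠ ⊤) (x : V) : green μ z x ≠ ⊤ :=
  ENNReal.ne_top_of_tsum_ne_top (expHit_eq_tsum_green μ z ▸ hT) x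

lemma voltage_ne_top (hT : expHit μ z ≠ ⊤) (x : V) : voltage G z μ x ≠ ⊤ :=
  ENNReal.div_ne_top (green_ne_top hT x) (G.vw_pos x).ne'

lemma tsum_w_mul_voltage :
    ∑' p : V × V, G.w p.1 p.2 * voltage G z μ p.1 = expHit μ z := by
  rw [ENNReal.tsum_prod (f := fun x y => G.w x y * voltage G z μ x), expHit_eq_tsum_green]
  refine tsum_congr fun x => ?_
  rw [ENNReal.tsum_mul_right, ← voltage_mul_vw (G := G), mul_comm, WeightedGraph.vw]

lemma summable_w_mul_voltage (hT : expHit μ z ≠ ⊤) :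
    Summable fun p : V × V => (G.w p.1 p.2).toReal * (voltage G z μ p.1).toReal := by
  rw [← tsum_w_mul_voltage (G := G)] at hT
  exact (ENNReal.summable_toReal hT).congr fun p => ENNReal.toReal_mul

lemma unitFlow_voltage (hμ : IsRandomWalk G o μ) (ho : o ∉ z) (hT : expHit μ z ≠ ⊤) :
    UnitFlow o (G.interior z) (G.entering z) fun x => (voltage G z μ x).toReal := by
  have hd : ∀ p, 0 ≤ G.interior z p := fun p => by
    rw [WeightedGraph.interior]; split_ifs <;> simp
  have he : ∀ p, 0 ≤ G.entering z p := fun p => by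
    rw [WeightedGraph.entering]; split_ifs <;> simp
  have hu : ∀ x, 0 ≤ (voltage G z μ x).toReal := fun x => ENNReal.toReal_nonneg
  refine ⟨fun p => ?_, hd, he, hu, ?_, ?_, fun x => ?_⟩
  · simp only [WeightedGraph.interior, Prod.fst_swap, Prod.snd_swap, G.symm p.2 p.1,
      and_comm (a := p.2 ∉ z)]
  · refine Summable.of_nonneg_of_le (fun p => mul_nonneg (hd p) (hu _)) (fun p => ?_)
      (summable_w_mul_voltage (G := G) hT)
    rw [← interior_add_entering]
    exact le_add_of_nonneg_right (mul_nonneg (he p) (hu _))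
  · refine Summable.of_nonneg_of_le (fun p => mul_nonneg (he p) (hu _)) (fun p => ?_)
      (summable_w_mul_voltage (G := G) hT)
    rw [← interior_add_entering]
    exact le_add_of_nonneg_left (mul_nonneg (hd p) (hu _))
  by_cases hx : x ∈ z
  · have hxo : x ≠ o := fun h => ho (h ▸ hx)
    simp [WeightedGraph.interior, WeightedGraph.entering, hx, hxo]
  have hterm : ∀ y, G.interior z (x, y) * ((voltage G z μ x).toReal - (voltage G z μ y).toReal)
      + G.entering z (x, y) * (voltage G z μ x).toReal
      = (G.w x y).toReal * (voltage G z μ x).toReal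
        - (voltage G z μ y * G.w y x).toReal := fun y => by
    rw [ENNReal.toReal_mul, G.symm y x]
    by_cases hy : y ∈ z
    · simp [WeightedGraph.interior, WeightedGraph.entering, hx, hy, voltage_eq_zero hy]
    · simp [WeightedGraph.interior, WeightedGraph.entering, hx, hy]
      ring
  have hG := green_eq hμ hx
  have hin : ∑' y, voltage G z μ y * G.w y x ≠ ⊤ := by
    refine ne_top_of_le_ne_top (green_ne_top hT x) ?_
    rw [hG]
    exact le_add_self
  have hvw : ∑' y, G.w x y ≠ ⊤ := (G.vw_lt_top x).ne
  simp_rw [hterm]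
  rw [((ENNReal.summable_toReal hvw).mul_right _).tsum_sub (ENNReal.summable_toReal hin),
    tsum_mul_right, ← ENNReal.tsum_toReal_eq (G.w_ne_top x),
    ← ENNReal.tsum_toReal_eq (ENNReal.ne_top_of_tsum_ne_top hin), ← ENNReal.toReal_mul,
    mul_comm]
  have h1 : voltage G z μ x * ∑' y, G.w x y = green μ z x := voltage_mul_vw x
  have h2 : green μ z x = (if x = o then 1 else 0) + ∑' y, voltage G z μ y * G.w y x := hG
  rw [h1, h2, ENNReal.toReal_add (by split_ifs <;> simp) hin]
  split_ifs <;> simp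

end Voltage

/-- With `g = (w_z r_{oz})^{1/n} > 1`, the expected hitting time satisfies
`E T_{oz} ≥ n (g+1)/(g-1) + 1`. -/
theorem expected_hitting_time_lower_bound_resistance
    {V : Type*} [Countable V] [MeasurableSpace V] [MeasurableSingletonClass V]
    (G : WeightedGraph V) (o : V) (z : Set V) (n : ℕ) (hn : 1 ≤ n) (g : ℝ)
    (μ : Measure (ℕ → V)) (hμ : IsRandomWalk G o μ)
    (hdist : G.distGE o z (n + 1))
    (hgdef : ENNReal.ofReal g = (G.setWeight z * resistance G o z μ) ^ ((n : ℝ)⁻¹))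
    (hg : 1 < g) :
    ENNReal.ofReal ((n : ℝ) * (g + 1) / (g - 1) + 1) ≤ expHit μ z := by
  by_cases hT : expHit μ z = ⊤
  · simp [hT]
  have ho := G.notMem_of_distGE hdist
  have F := unitFlow_voltage hμ ho hT
  have hres : resistance G o z μ = voltage G z μ o := by
    rw [resistance, lintegral_visitsBefore, voltage]
  have hvo : 0 < voltage G z μ o := by
    refine voltage_pos ?_
    rw [green_eq hμ ho, if_pos rfl]
    exact one_pos.trans_le le_self_add
  have hn0 : (n : ℝ) ≠ 0 := by positivity
  have hpow : G.setWeight z * voltage G z μ o = ENNReal.ofReal (g ^ n) := by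
    rw [ENNReal.ofReal_pow (by linarith), hgdef, hres, ← ENNReal.rpow_natCast,
      ← ENNReal.rpow_mul, inv_mul_cancel₀ hn0, ENNReal.rpow_one]
  have hgn : 0 < g ^ n := pow_pos (by linarith) n
  have hzt : G.setWeight z ≠ ⊤ := fun h => by
    rw [h, ENNReal.top_mul hvo.ne'] at hpow
    exact ENNReal.ofReal_ne_top hpow.symm
  have huo : 0 < (voltage G z μ o).toReal := ENNReal.toReal_pos hvo.ne' (voltage_ne_top hT o)
  have hreal : g ^ n = (G.setWeight z).toReal * (voltage G z μ o).toReal := by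
    rw [← ENNReal.toReal_mul, hpow, ENNReal.toReal_ofReal hgn.le]
  have hW : 0 < (G.setWeight z).toReal := by
    rw [hreal] at hgn
    exact pos_of_mul_pos_left hgn huo.le
  obtain ⟨hse, heW⟩ := G.tsum_entering_le hzt
  have hpos : ∀ p, G.interior z p ≠ 0 → 0 < (voltage G z μ p.1).toReal →
      0 < (voltage G z μ p.2).toReal := fun p hp h => by
    obtain ⟨-, h2, hw⟩ := G.w_pos_of_interior_ne_zero hp
    refine ENNReal.toReal_pos (voltage_pos ?_).ne' (voltage_ne_top hT _)
    have hv := (ENNReal.toReal_pos_iff.1 h).1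
    rw [green_eq hμ h2]
    refine (ENNReal.mul_pos hv.ne' hw.ne').trans_le (le_trans ?_ le_add_self)
    exact ENNReal.le_tsum (f := fun x => green μ z x / G.vw x * G.w x p.2) p.1
  have hmain := F.le_tsum hpos huo hW hse heW (h := fun x => (G.truncDist o n x : ℝ)) (n := n)
    (by simp [G.truncDist_self])
    (fun x => by simpa using G.truncDist_le o n x)
    (fun p hp => by
      have hw := (G.w_pos_of_interior_ne_zero hp).2.2
      have h1 := G.truncDist_le_add_one (o := o) (n := n) hw
      have h2 := G.truncDist_le_add_one (o := o) (n := n) (G.symm p.1 p.2 ▸ hw)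
      rw [abs_le]
      constructor
      · have : (G.truncDist o n p.2 : ℝ) ≤ G.truncDist o n p.1 + 1 := mod_cast h1
        linarith
      · have : (G.truncDist o n p.1 : ℝ) ≤ G.truncDist o n p.2 + 1 := mod_cast h2
        linarith)
    (fun p hp => by
      obtain ⟨h1, h2⟩ := G.w_pos_of_entering_ne_zero hp
      exact_mod_cast G.truncDist_eq_of_distGE hdist h1 h2)
    hg hreal
  refine ENNReal.ofReal_le_of_le_toReal (hmain.trans (le_of_eq ?_))
  rw [← F.summable_d.tsum_add F.summable_e, ← tsum_w_mul_voltage (G := G),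
    ENNReal.tsum_toReal_eq fun p : V × V =>
      ENNReal.mul_ne_top (G.w_ne_top p.1 p.2) (voltage_ne_top hT p.1)]
  exact tsum_congr fun p => by rw [ENNReal.toReal_mul, interior_add_entering]

end RWHitting
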